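/- Let H_x, H_y be complex Hilbert spaces, q ≥ 1, and let (x_1,y_1),…,(x_N,y_N) be i.i.d. samples from a probability measure P on H_x × H_y with E[‖x‖²‖y‖²] < ∞. Let σ_1,…,σ_N be i.i.d. Rademacher random variables independent of the samples, and define the random finite-rank operator T_yx = ∑_{n=1}^N σ_n y_n x_n* : H_x → H_y. Then E ‖T_yx‖_{S_q} ≤ N^{max(1/2, 1/q)} √( E[‖x‖² ‖y‖²] ). -/

import Mathlib

open MeasureTheory
open scoped InnerProductSpace ENNReal NNReal

/-- The `n`-th approximation number of a bounded operator between complex Hilbert spaces,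
`a_n(T) = inf { ‖T - A‖ : rank A ≤ n }` (indexed from `n = 0`).  For a compact operator on
Hilbert spaces this equals the `(n+1)`-st singular value `s_{n+1}(T)`, i.e. the `(n+1)`-st
eigenvalue of `|T| = (T*T)^{1/2}` in non-increasing order. -/
noncomputable def approxNumber {E F : Type*} [NormedAddCommGroup E] [NormedSpace ℂ E]
    [NormedAddCommGroup F] [NormedSpace ℂ F] (T : E →L[ℂ] F) (n : ℕ) : ℝ :=
  sInf {r : ℝ | ∃ A : E →L[ℂ] F, LinearMap.rank (A : E →ₗ[ℂ] F) ≤ (n : Cardinal) ∧ r = ‖T - A‖}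

/-- The Schatten `p`-norm `‖T‖_{S_p} = (∑_k s_k(T)^p)^{1/p}`. -/
noncomputable def schattenNorm {E F : Type*} [NormedAddCommGroup E] [NormedSpace ℂ E]
    [NormedAddCommGroup F] [NormedSpace ℂ F] (p : ℝ) (T : E →L[ℂ] F) : ℝ :=
  (∑' n : ℕ, approxNumber T n ^ p) ^ (1 / p)

/-- `T` belongs to the `p`-Schatten–von Neumann class `S_p`: `T` is compact and its singular
values are `ℓ^p`-summable. -/
def MemSchatten {E F : Type*} [NormedAddCommGroup E] [NormedSpace ℂ E]
    [NormedAddCommGroup F] [NormedSpace ℂ F] (p : ℝ) (T : E →L[ℂ] F) : Prop :=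
  IsCompactOperator T ∧ Summable fun n : ℕ => approxNumber T n ^ p

/-- The rank-one operator `a b* : H_b → H_a`, `x ↦ ⟨b, x⟩ a`. -/
noncomputable def rankOne {Ha Hb : Type*} [NormedAddCommGroup Ha] [InnerProductSpace ℂ Ha]
    [NormedAddCommGroup Hb] [InnerProductSpace ℂ Hb] (a : Ha) (b : Hb) : Hb →L[ℂ] Ha :=
  (innerSL ℂ b).smulRight a

/-- The Rademacher distribution on `ℝ`, uniform on `{-1, +1}`. -/
noncomputable def rademacherMeasure : Measure ℝ :=
  (2⁻¹ : ℝ≥0∞) • Measure.dirac 1 + (2⁻¹ : ℝ≥0∞) • Measure.dirac (-1)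

instance : IsProbabilityMeasure rademacherMeasure := by
  constructor
  simp [rademacherMeasure, ENNReal.inv_two_add_inv_two]

lemma rankOne_apply {Ha Hb : Type*} [NormedAddCommGroup Ha] [InnerProductSpace ℂ Ha]
    [NormedAddCommGroup Hb] [InnerProductSpace ℂ Hb] (a : Ha) (b x : Hb) :
    rankOne a b x = ⟪b, x⟫_ℂ • a := by
  simp [rankOne]

lemma rank_sum_rankOne_le {Ha Hb ι : Type*} [NormedAddCommGroup Ha] [InnerProductSpace ℂ Ha]
    [NormedAddCommGroup Hb] [InnerProductSpace ℂ Hb] (s : Finset ι) (a : ι → Ha) (b : ι → Hb) :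
    LinearMap.rank ((∑ i ∈ s, rankOne (a i) (b i) : Hb →L[ℂ] Ha) : Hb →ₗ[ℂ] Ha) ≤
      (s.card : Cardinal) := by
  classical
  have h : LinearMap.range ((∑ i ∈ s, rankOne (a i) (b i) : Hb →L[ℂ] Ha) : Hb →ₗ[ℂ] Ha) ≤
      Submodule.span ℂ ((s.image a : Finset Ha) : Set Ha) := by
    rintro _ ⟨x, rfl⟩
    simp only [ContinuousLinearMap.coe_coe, _root_.sum_apply, rankOne_apply]
    exact Submodule.sum_mem _ fun i hi => Submodule.smul_mem _ _
      (Submodule.subset_span (by simpa using ⟨i, hi, rfl⟩))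
  refine (Submodule.rank_mono h).trans ((rank_span_finset_le _).trans ?_)
  exact_mod_cast Finset.card_image_le

lemma approxNumber_nonneg {E F : Type*} [NormedAddCommGroup E] [NormedSpace ℂ E]
    [NormedAddCommGroup F] [NormedSpace ℂ F] (T : E →L[ℂ] F) (n : ℕ) :
    0 ≤ approxNumber T n := by
  refine Real.sInf_nonneg ?_
  rintro r ⟨A, -, rfl⟩
  exact norm_nonneg _

lemma approxNumber_le {E F : Type*} [NormedAddCommGroup E] [NormedSpace ℂ E]
    [NormedAddCommGroup F] [NormedSpace ℂ F] (T A : E →L[ℂ] F) {n : ℕ}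
    (hA : LinearMap.rank (A : E →ₗ[ℂ] F) ≤ (n : Cardinal)) :
    approxNumber T n ≤ ‖T - A‖ := by
  refine csInf_le ⟨0, ?_⟩ ⟨A, hA, rfl⟩
  rintro r ⟨A, -, rfl⟩
  exact norm_nonneg _

lemma approxNumber_eq_zero_of_rank_le {E F : Type*} [NormedAddCommGroup E] [NormedSpace ℂ E]
    [NormedAddCommGroup F] [NormedSpace ℂ F] (T : E →L[ℂ] F) {n : ℕ}
    (hT : LinearMap.rank (T : E →ₗ[ℂ] F) ≤ (n : Cardinal)) :
    approxNumber T n = 0 :=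
  le_antisymm (by simpa using approxNumber_le T T hT) (approxNumber_nonneg T n)

lemma norm_sum_sq_of_pairwise_inner_eq_zero {F ι : Type*} [NormedAddCommGroup F]
    [InnerProductSpace ℂ F] (s : Finset ι) (v : ι → F)
    (hv : Pairwise fun i j => ⟪v i, v j⟫_ℂ = 0) :
    ‖∑ i ∈ s, v i‖ ^ 2 = ∑ i ∈ s, ‖v i‖ ^ 2 := by
  classical
  induction s using Finset.induction_on with
  | empty => simp
  | insert i s hi ih =>
    rw [Finset.sum_insert hi, Finset.sum_insert hi, ← ih, sq, sq, sq]
    refine norm_add_sq_eq_norm_sq_add_norm_sq_of_inner_eq_zero (𝕜 := ℂ) _ _ ?_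
    rw [inner_sum]
    exact Finset.sum_eq_zero fun j hj => hv fun h => hi (h ▸ hj)

/-- A linear map on a finite-dimensional Hilbert space has an orthonormal basis of right singular
vectors, ordered by non-increasing singular values. -/
lemma exists_orthonormalBasis_singular {V F : Type*} [NormedAddCommGroup V]
    [InnerProductSpace ℂ V] [FiniteDimensional ℂ V] [NormedAddCommGroup F]
    [InnerProductSpace ℂ F] [CompleteSpace F] (L : V →L[ℂ] F) :
    ∃ e : OrthonormalBasis (Fin (Module.finrank ℂ V)) ℂ V,
      (Pairwise fun i j => ⟪L (e i), L (e j)⟫_ℂ = 0) ∧ Antitone fun i => ‖L (e i)‖ := by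
  have : CompleteSpace V := FiniteDimensional.complete ℂ V
  let S : V →ₗ[ℂ] V := (L.adjoint ∘L L : V →L[ℂ] V)
  have hSinner (x y : V) : ⟪S x, y⟫_ℂ = ⟪L x, L y⟫_ℂ := by
    simp [S, ContinuousLinearMap.adjoint_inner_left]
  have hS : S.IsSymmetric := fun x y => by
    rw [hSinner, ← inner_conj_symm x, hSinner, inner_conj_symm]
  have key (i j) : ⟪L (hS.eigenvectorBasis rfl i), L (hS.eigenvectorBasis rfl j)⟫_ℂ =
      (hS.eigenvalues rfl i : ℂ) * if i = j then 1 else 0 := by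
    rw [← hSinner, hS.apply_eigenvectorBasis, inner_smul_left,
      orthonormal_iff_ite.mp (hS.eigenvectorBasis rfl).orthonormal]
    simp
  have hnorm (i) : ‖L (hS.eigenvectorBasis rfl i)‖ ^ 2 = hS.eigenvalues rfl i := by
    have h := key i i
    rw [inner_self_eq_norm_sq_to_K, if_pos rfl, mul_one] at h
    exact Complex.ofReal_injective (by simpa using h)
  refine ⟨hS.eigenvectorBasis rfl, fun i j hij => by simp [key, hij], fun i j hij => ?_⟩
  refine (pow_le_pow_iff_left₀ (norm_nonneg _) (norm_nonneg _) two_ne_zero).mp ?_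
  rw [hnorm, hnorm]
  exact hS.eigenvalues_antitone rfl hij

/-- Singular value decomposition of a finite sum of rank-one operators, together with the
expression of its Hilbert-Schmidt norm in terms of Gram matrices. -/
lemma exists_orthonormal_singular {Hx Hy : Type*} [NormedAddCommGroup Hx]
    [InnerProductSpace ℂ Hx] [NormedAddCommGroup Hy] [InnerProductSpace ℂ Hy] [CompleteSpace Hy]
    {N : ℕ} (a : Fin N → Hx) (b : Fin N → Hy) (T : Hx →L[ℂ] Hy)
    (hT : T = ∑ n, rankOne (b n) (a n)) :
    ∃ d ≤ N, ∃ u : Fin d → Hx, Orthonormal ℂ u ∧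
      (Pairwise fun i j => ⟪T (u i), T (u j)⟫_ℂ = 0) ∧ (Antitone fun i => ‖T (u i)‖) ∧
      (T = ∑ i, rankOne (T (u i)) (u i)) ∧
      ∑ i, ‖T (u i)‖ ^ 2 = ∑ m, ∑ n, (⟪b m, b n⟫_ℂ * ⟪a n, a m⟫_ℂ).re := by
  classical
  have hTx (x : Hx) : T x = ∑ n, ⟪a n, x⟫_ℂ • b n := by
    simp [hT, rankOne_apply]
  let V : Submodule ℂ Hx := Submodule.span ℂ (Set.range a)
  have : FiniteDimensional ℂ V := FiniteDimensional.span_of_finite ℂ (Set.finite_range a)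
  have hd : Module.finrank ℂ V ≤ N := by
    simpa [Set.finrank, V] using finrank_range_le_card (R := ℂ) a
  have ha (n) : a n ∈ V := Submodule.subset_span ⟨n, rfl⟩
  obtain ⟨e, horth, hanti⟩ := exists_orthonormalBasis_singular (T ∘L V.subtypeL)
  have hparseval (m : Fin N) (x : Hx) : ⟪a m, x⟫_ℂ = ∑ i, ⟪a m, e i⟫_ℂ * ⟪(e i : Hx), x⟫_ℂ := by
    have h := congrArg (Subtype.val) (e.sum_repr' ⟨a m, ha m⟩)
    rw [Submodule.coe_sum] at h
    conv_lhs => rw [← show _ = a m from h]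
    simp [mul_comm]
  refine ⟨_, hd, fun i => e i, e.orthonormal.comp_linearIsometry V.subtypeₗᵢ, horth, hanti, ?_, ?_⟩
  · ext x
    simp only [_root_.sum_apply, rankOne_apply, hTx, Finset.smul_sum]
    rw [Finset.sum_comm]
    refine Finset.sum_congr rfl fun n _ => ?_
    rw [hparseval n x, Finset.sum_smul]
    simp [smul_smul, mul_comm]
  · have h (i) : ‖T (e i)‖ ^ 2 =
        ∑ m, ∑ n, (⟪b m, b n⟫_ℂ * (⟪a n, e i⟫_ℂ * ⟪(e i : Hx), a m⟫_ℂ)).re := by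
      rw [← inner_self_eq_norm_sq (𝕜 := ℂ), hTx, sum_inner]
      simp only [inner_sum, inner_smul_left, inner_smul_right, map_sum, inner_conj_symm]
      refine Finset.sum_congr rfl fun m _ => Finset.sum_congr rfl fun n _ => ?_
      simp only [RCLike.re_to_complex]
      congr 1
      ring
    simp only [h]
    rw [Finset.sum_comm]
    refine Finset.sum_congr rfl fun m _ => ?_
    rw [Finset.sum_comm]
    refine Finset.sum_congr rfl fun n _ => ?_
    rw [hparseval n (a m), Finset.mul_sum, Complex.re_sum]

lemma sum_approxNumber_sq_le {Hx Hy : Type*} [NormedAddCommGroup Hx]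
    [InnerProductSpace ℂ Hx] [NormedAddCommGroup Hy] [InnerProductSpace ℂ Hy] [CompleteSpace Hy]
    {N : ℕ} (a : Fin N → Hx) (b : Fin N → Hy) :
    ∑ k ∈ Finset.range N, approxNumber (∑ n, rankOne (b n) (a n)) k ^ 2 ≤
      ∑ m, ∑ n, (⟪b m, b n⟫_ℂ * ⟪a n, a m⟫_ℂ).re := by
  obtain ⟨d, hd, u, hu, horth, hanti, hsum, hHS⟩ := exists_orthonormal_singular a b _ rfl
  set T := ∑ n, rankOne (b n) (a n)
  have hzero (k : ℕ) (hk : d ≤ k) : approxNumber T k = 0 := by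
    refine approxNumber_eq_zero_of_rank_le T ?_
    rw [hsum]
    refine (rank_sum_rankOne_le _ _ _).trans ?_
    simpa using hk
  have hle (k : Fin d) : approxNumber T k ≤ ‖T (u k)‖ := by
    refine (approxNumber_le T (∑ i ∈ Finset.Iio k, rankOne (T (u i)) (u i)) ?_).trans ?_
    · simpa using rank_sum_rankOne_le (Finset.Iio k) (fun i => T (u i)) u
    · refine ContinuousLinearMap.opNorm_le_bound _ (norm_nonneg _) fun x => ?_
      have hx : (T - ∑ i ∈ Finset.Iio k, rankOne (T (u i)) (u i)) x =
          ∑ i ∈ (Finset.Iio k)ᶜ, ⟪u i, x⟫_ℂ • T (u i) := by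
        have hTx : T x = ∑ i, ⟪u i, x⟫_ℂ • T (u i) := by
          simpa [rankOne_apply] using congrArg (fun A : Hx →L[ℂ] Hy => A x) hsum
        rw [_root_.sub_apply, hTx, ← Finset.sum_add_sum_compl (Finset.Iio k)]
        simp [rankOne_apply]
      refine (pow_le_pow_iff_left₀ (norm_nonneg _) (by positivity) two_ne_zero).mp ?_
      rw [hx, norm_sum_sq_of_pairwise_inner_eq_zero, mul_pow]
      · calc ∑ i ∈ (Finset.Iio k)ᶜ, ‖⟪u i, x⟫_ℂ • T (u i)‖ ^ 2
            ≤ ∑ i ∈ (Finset.Iio k)ᶜ, ‖T (u k)‖ ^ 2 * ‖⟪u i, x⟫_ℂ‖ ^ 2 := by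
              refine Finset.sum_le_sum fun i hi => ?_
              rw [norm_smul, mul_pow, mul_comm]
              have : ‖T (u i)‖ ≤ ‖T (u k)‖ := hanti (by simpa using hi)
              gcongr
          _ ≤ ‖T (u k)‖ ^ 2 * ‖x‖ ^ 2 := by
              rw [← Finset.mul_sum]
              gcongr
              exact hu.sum_inner_products_le x
      · intro i j hij
        simp [horth hij]
  calc ∑ k ∈ Finset.range N, approxNumber T k ^ 2
      = ∑ k ∈ Finset.range d, approxNumber T k ^ 2 := by
        refine (Finset.sum_subset (by simpa using hd) fun k _ hk => ?_).symm
        rw [hzero k (by simpa using hk)]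
        simp
    _ = ∑ k : Fin d, approxNumber T k ^ 2 := Finset.sum_range _
    _ ≤ ∑ k : Fin d, ‖T (u k)‖ ^ 2 :=
        Finset.sum_le_sum fun k _ => pow_le_pow_left₀ (approxNumber_nonneg _ _) (hle k) 2
    _ = _ := hHS

lemma sum_rpow_le_rpow_sum {ι : Type*} (s : Finset ι) (f : ι → ℝ) (hf : ∀ i ∈ s, 0 ≤ f i)
    {p : ℝ} (hp : 1 ≤ p) : ∑ i ∈ s, f i ^ p ≤ (∑ i ∈ s, f i) ^ p := by
  classical
  induction s using Finset.induction_on with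
  | empty => simp [Real.zero_rpow (by linarith : p ≠ 0)]
  | insert i s hi ih =>
    rw [Finset.sum_insert hi, Finset.sum_insert hi]
    have hs : ∀ j ∈ s, 0 ≤ f j := fun j hj => hf j (Finset.mem_insert_of_mem hj)
    exact (add_le_add_right (ih hs) _).trans
      (Real.add_rpow_le_rpow_add (hf i (Finset.mem_insert_self i s)) (Finset.sum_nonneg hs) hp)

lemma sum_rpow_rpow_le {N : ℕ} (f : ℕ → ℝ) (hf : ∀ k, 0 ≤ f k) {q : ℝ} (hq : 1 ≤ q) :
    (∑ k ∈ Finset.range N, f k ^ q) ^ (1 / q) ≤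
      (N : ℝ) ^ (max 0 (1 / q - 1 / 2)) * Real.sqrt (∑ k ∈ Finset.range N, f k ^ 2) := by
  have hq0 : 0 < q := by linarith
  have hB : 0 ≤ ∑ k ∈ Finset.range N, f k ^ 2 := Finset.sum_nonneg fun k _ => sq_nonneg _
  have hA : 0 ≤ ∑ k ∈ Finset.range N, f k ^ q :=
    Finset.sum_nonneg fun k _ => Real.rpow_nonneg (hf k) _
  rcases le_total 2 q with h | h
  · have h1 : 1 / q - 1 / 2 ≤ 0 := by
      rw [sub_nonpos]
      exact one_div_le_one_div_of_le two_pos h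
    rw [max_eq_left h1, Real.rpow_zero, one_mul]
    have h2 : ∑ k ∈ Finset.range N, f k ^ q ≤ (∑ k ∈ Finset.range N, f k ^ 2) ^ (q / 2) := by
      refine le_trans (le_of_eq ?_) (sum_rpow_le_rpow_sum _ _ (fun k _ => sq_nonneg (f k))
        (by linarith : 1 ≤ q / 2))
      refine Finset.sum_congr rfl fun k _ => ?_
      rw [← Real.rpow_natCast, ← Real.rpow_mul (hf k)]
      congr 1
      push_cast
      ring
    refine (Real.rpow_le_rpow hA h2 (by positivity)).trans (le_of_eq ?_)
    rw [← Real.rpow_mul hB, Real.sqrt_eq_rpow]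
    congr 1
    field_simp
  · have h1 : 0 ≤ 1 / q - 1 / 2 := by
      rw [sub_nonneg]
      exact one_div_le_one_div_of_le hq0 h
    rw [max_eq_right h1]
    have h2 := Real.rpow_sum_le_const_mul_sum_rpow_of_nonneg (Finset.range N)
      (f := fun k => f k ^ q) (p := 2 / q) (by rwa [le_div_iff₀ hq0, one_mul])
      (fun k _ => Real.rpow_nonneg (hf k) _)
    have h3 (k : ℕ) : (f k ^ q) ^ (2 / q) = f k ^ 2 := by
      rw [← Real.rpow_mul (hf k), mul_div_cancel₀ _ hq0.ne', Real.rpow_two]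
    simp only [h3, Finset.card_range] at h2
    have h4 := Real.rpow_le_rpow (by positivity) h2 (by norm_num : (0 : ℝ) ≤ 1 / 2)
    rw [← Real.rpow_mul hA, Real.mul_rpow (by positivity) hB, ← Real.rpow_mul (by positivity),
      ← Real.sqrt_eq_rpow] at h4
    convert h4 using 3
    · field_simp
    · field_simp

lemma schattenNorm_sum_rankOne_le {Hx Hy : Type*} [NormedAddCommGroup Hx]
    [InnerProductSpace ℂ Hx] [NormedAddCommGroup Hy] [InnerProductSpace ℂ Hy] [CompleteSpace Hy]
    {N : ℕ} (a : Fin N → Hx) (b : Fin N → Hy) {q : ℝ} (hq : 1 ≤ q) :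
    schattenNorm q (∑ n, rankOne (b n) (a n)) ≤ (N : ℝ) ^ (max 0 (1 / q - 1 / 2)) *
      Real.sqrt (∑ m, ∑ n, (⟪b m, b n⟫_ℂ * ⟪a n, a m⟫_ℂ).re) := by
  have htsum : ∑' k, approxNumber (∑ n, rankOne (b n) (a n)) k ^ q =
      ∑ k ∈ Finset.range N, approxNumber (∑ n, rankOne (b n) (a n)) k ^ q := by
    refine tsum_eq_sum fun k hk => ?_
    rw [approxNumber_eq_zero_of_rank_le, Real.zero_rpow (by linarith)]
    refine (rank_sum_rankOne_le _ _ _).trans ?_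
    simpa using hk
  rw [schattenNorm, htsum]
  refine (sum_rpow_rpow_le _ (approxNumber_nonneg _) hq).trans ?_
  gcongr
  exact sum_approxNumber_sq_le a b

lemma schattenNorm_nonneg {E F : Type*} [NormedAddCommGroup E] [NormedSpace ℂ E]
    [NormedAddCommGroup F] [NormedSpace ℂ F] (q : ℝ) (T : E →L[ℂ] F) : 0 ≤ schattenNorm q T :=
  Real.rpow_nonneg (tsum_nonneg fun n => Real.rpow_nonneg (approxNumber_nonneg T n) q) _

lemma smul_rankOne {Ha Hb : Type*} [NormedAddCommGroup Ha] [InnerProductSpace ℂ Ha]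
    [NormedAddCommGroup Hb] [InnerProductSpace ℂ Hb] (c : ℝ) (a : Ha) (b : Hb) :
    c • rankOne a b = rankOne ((c : ℂ) • a) b := by
  ext x
  simp [rankOne_apply, smul_comm c]

lemma integrable_smul_dirac (f : ℝ → ℝ) (a : ℝ) :
    Integrable f ((2⁻¹ : ℝ≥0∞) • Measure.dirac a) :=
  (integrable_dirac (by simp)).smul_measure (by simp)

lemma integral_rademacherMeasure (f : ℝ → ℝ) :
    ∫ x, f x ∂rademacherMeasure = (f 1 + f (-1)) / 2 := by
  rw [rademacherMeasure,
    integral_add_measure (integrable_smul_dirac f _) (integrable_smul_dirac f _)]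
  simp
  ring

lemma memLp_two_rademacherMeasure : MemLp (fun x : ℝ => x) 2 rademacherMeasure := by
  rw [memLp_two_iff_integrable_sq (by fun_prop)]
  exact (integrable_smul_dirac _ _).add_measure (integrable_smul_dirac _ _)

lemma integrable_rademacher_mul {N : ℕ} (m n : Fin N) :
    Integrable (fun σ : Fin N → ℝ => σ m * σ n)
      (Measure.pi fun _ : Fin N => rademacherMeasure) :=
  MemLp.integrable_mul
    (memLp_two_rademacherMeasure.comp_measurePreserving (measurePreserving_eval _ m))
    (memLp_two_rademacherMeasure.comp_measurePreserving (measurePreserving_eval _ n))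

lemma integral_rademacher_mul {N : ℕ} (m n : Fin N) :
    ∫ σ : Fin N → ℝ, σ m * σ n ∂(Measure.pi fun _ : Fin N => rademacherMeasure) =
      if m = n then 1 else 0 := by
  split_ifs with h
  · subst h
    rw [integral_comp_eval (μ := fun _ : Fin N => rademacherMeasure) (i := m)
      (f := fun x : ℝ => x * x) (by fun_prop), integral_rademacherMeasure]
    norm_num
  · have hind := (ProbabilityTheory.iIndepFun_pi (μ := fun _ : Fin N => rademacherMeasure)
      (X := fun _ x => x) (fun _ => aemeasurable_id)).indepFun h
    rw [hind.integral_fun_mul_eq_mul_integral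
        (measurable_pi_apply m).aestronglyMeasurable (measurable_pi_apply n).aestronglyMeasurable,
      integral_comp_eval (μ := fun _ : Fin N => rademacherMeasure) (i := m)
      (f := fun x : ℝ => x) (by fun_prop), integral_rademacherMeasure]
    norm_num

lemma integral_rademacher_quadratic {N : ℕ} (c : Fin N → Fin N → ℝ) :
    Integrable (fun σ : Fin N → ℝ => ∑ m, ∑ n, σ m * σ n * c m n)
      (Measure.pi fun _ : Fin N => rademacherMeasure) ∧
    ∫ σ : Fin N → ℝ, ∑ m, ∑ n, σ m * σ n * c m n
      ∂(Measure.pi fun _ : Fin N => rademacherMeasure) = ∑ n, c n n := by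
  have hint (m n : Fin N) := (integrable_rademacher_mul m n).mul_const (c m n)
  refine ⟨integrable_finsetSum _ fun m _ => integrable_finsetSum _ fun n _ => hint m n, ?_⟩
  rw [integral_finsetSum _ fun m _ => integrable_finsetSum _ fun n _ => hint m n]
  refine Finset.sum_congr rfl fun m _ => ?_
  rw [integral_finsetSum _ fun n _ => hint m n]
  simp [integral_mul_const, integral_rademacher_mul]

lemma sqrt_le_half_div_add {x t : ℝ} (hx : 0 ≤ x) (ht : 0 < t) :
    Real.sqrt x ≤ (x / t + t) / 2 := by
  rw [div_add' _ _ _ ht.ne', div_div, le_div_iff₀ (by positivity)]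
  nlinarith [sq_nonneg (Real.sqrt x - t), Real.sq_sqrt hx]

/-- Conditionally on the samples, the expected Schatten norm is controlled by the second moment. -/
lemma integral_schattenNorm_rademacher_le {Hx Hy : Type*} [NormedAddCommGroup Hx]
    [InnerProductSpace ℂ Hx] [NormedAddCommGroup Hy] [InnerProductSpace ℂ Hy] [CompleteSpace Hy]
    {N : ℕ} (a : Fin N → Hx) (b : Fin N → Hy) {q : ℝ} (hq : 1 ≤ q) {t : ℝ} (ht : 0 < t) :
    ∫ σ, schattenNorm q (∑ n : Fin N, σ n • rankOne (b n) (a n))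
        ∂(Measure.pi fun _ : Fin N => rademacherMeasure) ≤
      (N : ℝ) ^ (max 0 (1 / q - 1 / 2)) * (((∑ n, ‖a n‖ ^ 2 * ‖b n‖ ^ 2) / t + t) / 2) := by
  obtain ⟨hint, hval⟩ :=
    integral_rademacher_quadratic fun m n => (⟪b m, b n⟫_ℂ * ⟪a n, a m⟫_ℂ).re
  have hdiag (n : Fin N) : (⟪b n, b n⟫_ℂ * ⟪a n, a n⟫_ℂ).re = ‖a n‖ ^ 2 * ‖b n‖ ^ 2 := by
    rw [inner_self_eq_norm_sq_to_K, inner_self_eq_norm_sq_to_K]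
    simp [← Complex.ofReal_pow, mul_comm]
  simp only [hdiag] at hval
  set c : ℝ := (N : ℝ) ^ (max 0 (1 / q - 1 / 2))
  have hc : 0 ≤ c := by positivity
  have hbound : Integrable (fun σ : Fin N → ℝ => c *
      (((∑ m, ∑ n, σ m * σ n * (⟪b m, b n⟫_ℂ * ⟪a n, a m⟫_ℂ).re) / t + t) / 2))
      (Measure.pi fun _ : Fin N => rademacherMeasure) :=
    (((hint.div_const t).add (integrable_const t)).div_const 2).const_mul c
  refine (integral_mono_of_nonneg (Filter.Eventually.of_forall fun σ => schattenNorm_nonneg q _)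
    hbound (Filter.Eventually.of_forall fun σ => ?_)).trans (le_of_eq ?_)
  · have hgram (m n : Fin N) : (⟪(σ m : ℂ) • b m, (σ n : ℂ) • b n⟫_ℂ * ⟪a n, a m⟫_ℂ).re =
        σ m * σ n * (⟪b m, b n⟫_ℂ * ⟪a n, a m⟫_ℂ).re := by
      rw [inner_smul_left, inner_smul_right, Complex.conj_ofReal, mul_assoc, mul_assoc,
        Complex.re_ofReal_mul, Complex.re_ofReal_mul, mul_assoc]
    have hle := schattenNorm_sum_rankOne_le a (fun n => (σ n : ℂ) • b n) hq
    have hnonneg := (Finset.sum_nonneg fun k _ => sq_nonneg _).trans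
      (sum_approxNumber_sq_le a fun n => (σ n : ℂ) • b n)
    simp only [hgram] at hle hnonneg
    simp only [smul_rankOne]
    exact hle.trans (mul_le_mul_of_nonneg_left (sqrt_le_half_div_add hnonneg ht) hc)
  · rw [integral_const_mul, integral_div, integral_add (hint.div_const t) (integrable_const t),
      integral_div, hval]
    simp

/-- for i.i.d. samples `(x_n, y_n) ~ P` with `E[‖x‖²‖y‖²] < ∞` and independent
i.i.d. Rademacher signs `σ_n`, the random operator `T_yx = ∑_n σ_n y_n x_n*` satisfies
`E ‖T_yx‖_{S_q} ≤ N^{max(1/2, 1/q)} √(E[‖x‖²‖y‖²])`. -/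
theorem statement4
    {Hx Hy : Type*} [NormedAddCommGroup Hx] [InnerProductSpace ℂ Hx] [CompleteSpace Hx]
    [NormedAddCommGroup Hy] [InnerProductSpace ℂ Hy] [CompleteSpace Hy]
    [MeasurableSpace Hx] [BorelSpace Hx] [MeasurableSpace Hy] [BorelSpace Hy]
    (q : ℝ) (hq : 1 ≤ q)
    (P : Measure (Hx × Hy)) [IsProbabilityMeasure P]
    (hxy : Integrable (fun z : Hx × Hy => ‖z.1‖ ^ 2 * ‖z.2‖ ^ 2) P)
    (N : ℕ) :
    (∫ z, (∫ σ,
        schattenNorm q (∑ n : Fin N, σ n • rankOne (z n).2 (z n).1)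
        ∂(Measure.pi fun _ : Fin N => rademacherMeasure))
      ∂(Measure.pi fun _ : Fin N => P)) ≤
      (N : ℝ) ^ (max (1 / 2 : ℝ) (1 / q)) * Real.sqrt (∫ z, ‖z.1‖ ^ 2 * ‖z.2‖ ^ 2 ∂P) := by
  set c : ℝ := (N : ℝ) ^ (max 0 (1 / q - 1 / 2)) with hcdef
  set M : ℝ := ∫ z, ‖z.1‖ ^ 2 * ‖z.2‖ ^ 2 ∂P
  have hc : 0 ≤ c := by positivity
  have hM : 0 ≤ M := integral_nonneg fun z => by positivity
  have hint (n : Fin N) : Integrable (fun z : Fin N → Hx × Hy => ‖(z n).1‖ ^ 2 * ‖(z n).2‖ ^ 2)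
      (Measure.pi fun _ : Fin N => P) :=
    (measurePreserving_eval (fun _ : Fin N => P) n).integrable_comp_of_integrable hxy
  have hval (n : Fin N) : ∫ z : Fin N → Hx × Hy, ‖(z n).1‖ ^ 2 * ‖(z n).2‖ ^ 2
      ∂(Measure.pi fun _ : Fin N => P) = M :=
    integral_comp_eval (μ := fun _ : Fin N => P) (i := n)
      (f := fun z : Hx × Hy => ‖z.1‖ ^ 2 * ‖z.2‖ ^ 2) hxy.aestronglyMeasurable
  have hsum := integrable_finsetSum Finset.univ fun n _ => hint n
  have key (t : ℝ) (ht : 0 < t) : (∫ z, (∫ σ,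
        schattenNorm q (∑ n : Fin N, σ n • rankOne (z n).2 (z n).1)
        ∂(Measure.pi fun _ : Fin N => rademacherMeasure))
      ∂(Measure.pi fun _ : Fin N => P)) ≤ c * ((N * M / t + t) / 2) := by
    refine (integral_mono_of_nonneg
      (Filter.Eventually.of_forall fun z => integral_nonneg fun σ => schattenNorm_nonneg q _)
      ((((hsum.div_const t).add (integrable_const t)).div_const 2).const_mul c)
      (Filter.Eventually.of_forall fun z => integral_schattenNorm_rademacher_le
        (fun n => (z n).1) (fun n => (z n).2) hq ht)).trans (le_of_eq ?_)
    simp only [Pi.add_apply]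
    rw [integral_const_mul, integral_div, integral_add (hsum.div_const t) (integrable_const t),
      integral_div, integral_finsetSum _ fun n _ => hint n]
    simp [hval]
  have hpow : (N : ℝ) ^ (max (1 / 2 : ℝ) (1 / q)) * Real.sqrt M = c * Real.sqrt (N * M) := by
    rw [Real.sqrt_mul (Nat.cast_nonneg N), ← mul_assoc, Real.sqrt_eq_rpow (N : ℝ), hcdef,
      ← Real.rpow_add_of_nonneg (Nat.cast_nonneg N) (le_max_left _ _) (by norm_num),
      ← max_add_add_right, zero_add, sub_add_cancel]
  rw [hpow]
  refine le_of_forall_pos_le_add fun ε hε => ?_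
  have hs := Real.sqrt_nonneg (N * M)
  have hδ : 0 < ε / (c + 1) := by positivity
  refine (key (Real.sqrt (N * M) + ε / (c + 1)) (by positivity)).trans ?_
  have h1 : (N * M / (Real.sqrt (N * M) + ε / (c + 1)) + (Real.sqrt (N * M) + ε / (c + 1))) / 2 ≤
      Real.sqrt (N * M) + ε / (c + 1) := by
    have h2 : N * M / (Real.sqrt (N * M) + ε / (c + 1)) ≤ Real.sqrt (N * M) + ε / (c + 1) := by
      rw [div_le_iff₀ (by positivity)]
      nlinarith [Real.sq_sqrt (by positivity : 0 ≤ N * M)]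
    linarith
  refine (mul_le_mul_of_nonneg_left h1 hc).trans ?_
  rw [mul_add]
  gcongr
  rw [mul_div_assoc', div_le_iff₀ (by positivity)]
  nlinarith
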